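/- Nonterminating Saalschütz identity (Gasper–Rahman (II.24)): let a, b, c, e ∈ ℂ, assume e is not an integer and none of a, b, c, a−e+1, b−e+1, c−e+1, a+b+c−e+1, a+b+c−2e+2 is a nonpositive integer. Then ∑_{k=0}^∞ (a)_k (b)_k (c)_k / ((e)_k (a+b+c−e+1)_k · k!) + [Γ(e−1) Γ(a−e+1) Γ(b−e+1) Γ(c−e+1) Γ(a+b+c−e+1) / (Γ(1−e) Γ(a) Γ(b) Γ(c) Γ(a+b+c−2e+2))] · ∑_{k=0}^∞ (a−e+1)_k (b−e+1)_k (c−e+1)_k / ((2−e)_k (a+b+c−2e+2)_k · k!) = Γ(a−e+1) Γ(b−e+1) Γ(c−e+1) Γ(a+b+c−e+1) / (Γ(1−e) Γ(b+c−e+1) Γ(a+c−e+1) Γ(a+b−e+1)), where both series converge absolutely. -/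

import Mathlib

open Complex

/-- Pochhammer symbol `(a)_k = a (a+1) ⋯ (a+k-1)`. -/
noncomputable def poch (a : ℂ) (k : ℕ) : ℂ := ∏ i ∈ Finset.range k, (a + i)

open Filter Topology

/-- The reciprocal Gamma function, an entire function. -/
noncomputable def rGamma (z : ℂ) : ℂ := (Complex.Gamma z)⁻¹

lemma rGamma_eq_mul (z : ℂ) : rGamma z = z * rGamma (z + 1) :=
  Complex.one_div_Gamma_eq_self_mul_one_div_Gamma_add_one z

lemma continuous_rGamma : Continuous rGamma :=
  Complex.differentiable_one_div_Gamma.continuous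

lemma rGamma_mul_rGamma_one_sub (z : ℂ) :
    rGamma z * rGamma (1 - z) = Complex.sin (Real.pi * z) / Real.pi := by
  rw [rGamma, rGamma, ← mul_inv, Complex.Gamma_mul_Gamma_one_sub, inv_div]

@[simp] lemma poch_zero (z : ℂ) : poch z 0 = 1 := by simp [poch]

lemma poch_succ (z : ℂ) (n : ℕ) : poch z (n + 1) = poch z n * (z + n) :=
  Finset.prod_range_succ _ _

lemma poch_mul_rGamma_add (z : ℂ) (n : ℕ) : poch z n * rGamma (z + n) = rGamma z := by
  induction n with
  | zero => simp
  | succ n ih =>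
    rw [← ih, rGamma_eq_mul (z + n), poch_succ]
    push_cast
    ring_nf

lemma poch_ne_zero {z : ℂ} (hz : ∀ m : ℕ, z ≠ -(m : ℂ)) (n : ℕ) : poch z n ≠ 0 :=
  Finset.prod_ne_zero_iff.mpr fun i _ h => hz i (eq_neg_of_add_eq_zero_left h)

lemma tendsto_add_nat_div_nat (z : ℂ) :
    Tendsto (fun n : ℕ => (z + n) / (n : ℂ)) atTop (𝓝 1) := by
  have h : Tendsto (fun n : ℕ => z / (n : ℂ) + 1) atTop (𝓝 (0 + 1)) :=
    (tendsto_const_div_atTop_nhds_zero_nat z).add_const 1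
  rw [zero_add] at h
  refine h.congr' ?_
  filter_upwards [eventually_ne_atTop 0] with n hn
  have : (n : ℂ) ≠ 0 := by exact_mod_cast hn
  field_simp

/-- The comparison scale `n ^ (z - 1) * n!` for `Γ (z + n)`. -/
noncomputable def gammaScale (z : ℂ) (n : ℕ) : ℂ := (n : ℂ) ^ (z - 1) * (n.factorial : ℂ)

lemma gammaScale_ne_zero (z : ℂ) {n : ℕ} (hn : n ≠ 0) : gammaScale z n ≠ 0 := by
  have : (n : ℂ) ≠ 0 := by exact_mod_cast hn
  exact mul_ne_zero (by simp [Complex.cpow_eq_zero_iff, this])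
    (by exact_mod_cast n.factorial_ne_zero)

lemma tendsto_rGamma_mul_gammaScale (z : ℂ) :
    Tendsto (fun n : ℕ => rGamma (z + n) * gammaScale z n) atTop (𝓝 1) := by
  obtain ⟨m, hm⟩ := exists_nat_gt (-z.re)
  induction m generalizing z with
  | zero =>
    have hz : 0 < z.re := by simpa using hm
    have hp : ∀ m : ℕ, z ≠ -(m : ℂ) := by
      intro m h
      rw [h] at hz
      simp at hz
      linarith [(Nat.cast_nonneg m : (0 : ℝ) ≤ m)]
    have h := ((tendsto_add_nat_div_nat z).mul
      (Complex.GammaSeq_tendsto_Gamma z)).const_mul (rGamma z)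
    have e : rGamma z * (1 * Complex.Gamma z) = 1 := by
      rw [rGamma, one_mul, inv_mul_cancel₀ (Complex.Gamma_ne_zero hp)]
    rw [e] at h
    refine h.congr' ?_
    filter_upwards [eventually_ne_atTop 0] with n hn
    have hn' : (n : ℂ) ≠ 0 := by exact_mod_cast hn
    have hpo := poch_ne_zero hp n
    have hzn : z + n ≠ 0 := fun h => hp n (eq_neg_of_add_eq_zero_left h)
    have e2 : Complex.GammaSeq z n = (n : ℂ) ^ z * n.factorial / (poch z n * (z + n)) := by
      rw [Complex.GammaSeq, ← poch_succ, poch]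
    rw [e2, ← poch_mul_rGamma_add z n, gammaScale, Complex.cpow_sub _ _ hn', Complex.cpow_one]
    field_simp
  | succ m ih =>
    have h := (tendsto_add_nat_div_nat z).mul (ih (z + 1) (by simp at hm ⊢; linarith))
    rw [one_mul] at h
    refine h.congr' ?_
    filter_upwards [eventually_ne_atTop 0] with n hn
    have hn' : (n : ℂ) ≠ 0 := by exact_mod_cast hn
    rw [rGamma_eq_mul (z + n), gammaScale, gammaScale, add_sub_cancel_right,
      Complex.cpow_sub _ _ hn', Complex.cpow_one, show z + 1 + n = z + n + 1 by ring]
    field_simp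

lemma tendsto_poch_div_gammaScale (z : ℂ) :
    Tendsto (fun n : ℕ => poch z n / gammaScale z n) atTop (𝓝 (rGamma z)) := by
  have h := (tendsto_rGamma_mul_gammaScale z).inv₀ one_ne_zero |>.const_mul (rGamma z)
  rw [inv_one, mul_one] at h
  refine h.congr' ?_
  filter_upwards [eventually_ne_atTop 0, (tendsto_rGamma_mul_gammaScale z).eventually_ne
    one_ne_zero] with n hn h1
  have h2 := left_ne_zero_of_mul h1
  have h3 := right_ne_zero_of_mul h1
  rw [← poch_mul_rGamma_add z n]
  field_simp

lemma exists_norm_add_nat_bounds (R : ℝ) : ∃ K : ℕ, 0 < K ∧ ∀ z : ℂ, ‖z‖ ≤ R → ∀ k : ℕ, K ≤ k →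
    k * Real.exp (z.re / k - R ^ 2 / k ^ 2) ≤ ‖z + k‖ ∧
    ‖z + k‖ ≤ k * Real.exp (z.re / k + R ^ 2 / k ^ 2) := by
  obtain ⟨K, hK⟩ := exists_nat_gt (2 * R)
  refine ⟨K + 1, K.succ_pos, fun z hz k hk => ?_⟩
  have hk0 : (0 : ℝ) < k := by exact_mod_cast (by omega : 0 < k)
  have hkc : (k : ℂ) ≠ 0 := by exact_mod_cast hk0.ne'
  have hkK : (K : ℝ) + 1 ≤ k := by exact_mod_cast hk
  set w : ℂ := z / k with hw
  have hwn : ‖w‖ = ‖z‖ / k := by simp [hw]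
  have hwR : ‖w‖ ≤ R / k := by rw [hwn]; gcongr
  have hw2 : ‖w‖ ≤ 1 / 2 := hwR.trans (by rw [div_le_iff₀ hk0]; linarith)
  have hlog := Complex.norm_log_one_add_sub_self_le (z := w) (by linarith)
  have hb : ‖w‖ ^ 2 * (1 - ‖w‖)⁻¹ / 2 ≤ R ^ 2 / k ^ 2 := by
    have h1 : (1 - ‖w‖)⁻¹ ≤ 2 := by
      rw [inv_le_comm₀ (by linarith) (by norm_num)]; linarith
    have h2 : ‖w‖ ^ 2 ≤ R ^ 2 / k ^ 2 := by
      rw [← div_pow]; gcongr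
    nlinarith [sq_nonneg ‖w‖]
  have hre := (Complex.abs_re_le_norm _).trans (hlog.trans hb)
  have hne : 1 + w ≠ 0 := by
    intro h
    have : w = -1 := by linear_combination h
    rw [this] at hw2
    norm_num at hw2
  have hnorm : ‖z + k‖ = k * Real.exp (Complex.log (1 + w)).re := by
    rw [← Complex.norm_exp, Complex.exp_log hne, hw]
    rw [show z + k = k * (1 + z / k) by field_simp; ring, norm_mul, Complex.norm_natCast]
  have hwre : w.re = z.re / k := by rw [hw, Complex.div_natCast_re]
  rw [Complex.sub_re, hwre, abs_le] at hre
  rw [hnorm]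
  constructor <;> gcongr <;> linarith

lemma exists_raabe_bound (R δ : ℝ) (hδ : 0 < δ) : ∃ K : ℕ, 0 < K ∧ ∀ a b c e f : ℂ,
    ‖a‖ ≤ R → ‖b‖ ≤ R → ‖c‖ ≤ R → ‖e‖ ≤ R → ‖f‖ ≤ R →
    2 * δ ≤ e.re + f.re - a.re - b.re - c.re → ∀ k : ℕ, K ≤ k →
    e + k ≠ 0 ∧ f + k ≠ 0 ∧
    ‖(a + k) * (b + k) * (c + k)‖ * ((k + 1 : ℕ) : ℝ) ^ (1 + δ) ≤
      ‖(e + k) * (f + k) * (1 + k)‖ * (k : ℝ) ^ (1 + δ) := by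
  obtain ⟨K₁, hK₁, h₁⟩ := exists_norm_add_nat_bounds (max R 1)
  set C := (max R 1) ^ 2
  obtain ⟨K₂, hK₂⟩ := exists_nat_gt (6 * C / δ)
  refine ⟨K₁ + K₂, by omega, fun a b c e f ha hb hc he hf hs k hk => ?_⟩
  have hk0 : (0 : ℝ) < k := by exact_mod_cast (by omega : 0 < k)
  have hkK : (K₁ : ℝ) + K₂ ≤ k := by exact_mod_cast hk
  have hkC : 6 * C / k ≤ δ := by
    rw [div_lt_iff₀ hδ] at hK₂
    rw [div_le_iff₀ hk0]
    nlinarith [(Nat.cast_nonneg K₁ : (0 : ℝ) ≤ K₁)]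
  have B := fun z hz => h₁ z (le_trans hz (le_max_left R 1)) k (by omega)
  have hpos : ∀ z : ℂ, ‖z‖ ≤ R → z + k ≠ 0 := fun z hz => norm_pos_iff.mp <|
    lt_of_lt_of_le (by positivity) (B z hz).1
  refine ⟨hpos e he, hpos f hf, ?_⟩
  have hpow : ((k + 1 : ℕ) : ℝ) ^ (1 + δ) ≤ (k : ℝ) ^ (1 + δ) * Real.exp ((1 + δ) / k) := by
    have : ((k + 1 : ℕ) : ℝ) ≤ k * Real.exp (1 / k) := by
      have := Real.add_one_le_exp (1 / (k : ℝ))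
      calc ((k + 1 : ℕ) : ℝ) = k * (1 / k + 1) := by push_cast; field_simp; ring
        _ ≤ _ := by gcongr
    calc _ ≤ (k * Real.exp (1 / k)) ^ (1 + δ) := by gcongr
      _ = _ := by
        rw [Real.mul_rpow hk0.le (Real.exp_pos _).le, ← Real.exp_mul]
        ring_nf
  simp only [norm_mul]
  calc ‖a + k‖ * ‖b + k‖ * ‖c + k‖ * ((k + 1 : ℕ) : ℝ) ^ (1 + δ)
      ≤ (k * Real.exp (a.re / k + C / k ^ 2)) * (k * Real.exp (b.re / k + C / k ^ 2)) *
        (k * Real.exp (c.re / k + C / k ^ 2)) *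
          ((k : ℝ) ^ (1 + δ) * Real.exp ((1 + δ) / k)) := by
        gcongr
        exacts [(B a ha).2, (B b hb).2, (B c hc).2]
    _ = k ^ 3 * (k : ℝ) ^ (1 + δ) * Real.exp ((a.re / k + C / k ^ 2) + (b.re / k + C / k ^ 2) +
          (c.re / k + C / k ^ 2) + (1 + δ) / k) := by
        simp only [Real.exp_add]; ring
    _ ≤ k ^ 3 * (k : ℝ) ^ (1 + δ) * Real.exp ((e.re / k - C / k ^ 2) + (f.re / k - C / k ^ 2) +
          ((1 : ℂ).re / k - C / k ^ 2)) := by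
        refine mul_le_mul_of_nonneg_left (Real.exp_le_exp.mpr ?_) (by positivity)
        have : (e.re / k - C / k ^ 2) + (f.re / k - C / k ^ 2) + ((1 : ℂ).re / k - C / k ^ 2) -
          ((a.re / k + C / k ^ 2) + (b.re / k + C / k ^ 2) +
          (c.re / k + C / k ^ 2) + (1 + δ) / k) =
          ((e.re + f.re - a.re - b.re - c.re) - 6 * C / k - δ) / k := by
          simp only [Complex.one_re]
          field_simp
          ring
        have h2 : 0 ≤ ((e.re + f.re - a.re - b.re - c.re) - 6 * C / k - δ) / k :=
          div_nonneg (by linarith) hk0.le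
        linarith
    _ = (k * Real.exp (e.re / k - C / k ^ 2)) * (k * Real.exp (f.re / k - C / k ^ 2)) *
        (k * Real.exp ((1 : ℂ).re / k - C / k ^ 2)) * (k : ℝ) ^ (1 + δ) := by
        simp only [Real.exp_add]; ring
    _ ≤ _ := by
        gcongr
        exacts [(B e he).1, (B f hf).1, (h₁ 1 (by simp) k (by omega)).1]

lemma tendsto_poch_mul_rGamma {z w z' w' : ℂ} :
    Tendsto (fun n : ℕ => poch z n * poch w n * (rGamma (z' + n) * rGamma (w' + n)) *
      (n : ℂ) ^ (z' + w' - z - w)) atTop (𝓝 (rGamma z * rGamma w)) := by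
  have h := ((tendsto_poch_div_gammaScale z).mul (tendsto_poch_div_gammaScale w)).mul
    ((tendsto_rGamma_mul_gammaScale z').mul (tendsto_rGamma_mul_gammaScale w'))
  rw [mul_one, mul_one] at h
  refine h.congr' ?_
  filter_upwards [eventually_ne_atTop 0] with n hn
  have hn' : (n : ℂ) ≠ 0 := by exact_mod_cast hn
  have key : gammaScale z' n * gammaScale w' n =
      gammaScale z n * gammaScale w n * (n : ℂ) ^ (z' + w' - z - w) := by
    rw [show z' + w' - z - w = (z' - 1) + (w' - 1) - (z - 1) - (w - 1) by ring,
      Complex.cpow_sub _ _ hn', Complex.cpow_sub _ _ hn', Complex.cpow_add _ _ hn']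
    have h1 : (n : ℂ) ^ (z - 1) ≠ 0 := by simp [Complex.cpow_eq_zero_iff, hn]
    have h2 : (n : ℂ) ^ (w - 1) ≠ 0 := by simp [Complex.cpow_eq_zero_iff, hn]
    simp only [gammaScale]
    field_simp
  have hz := gammaScale_ne_zero z hn
  have hw := gammaScale_ne_zero w hn
  calc _ = poch z n * poch w n * (rGamma (z' + n) * rGamma (w' + n)) *
        (gammaScale z' n * gammaScale w' n) / (gammaScale z n * gammaScale w n) := by
        field_simp
    _ = _ := by rw [key]; field_simp

lemma tendsto_poch_mul_rGamma_of_add_eq {z w z' w' : ℂ} (h : z + w = z' + w') :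
    Tendsto (fun n : ℕ => poch z n * poch w n * (rGamma (z' + n) * rGamma (w' + n)))
      atTop (𝓝 (rGamma z * rGamma w)) := by
  have := tendsto_poch_mul_rGamma (z := z) (w := w) (z' := z') (w' := w')
  simpa [show z' + w' - z - w = 0 by linear_combination -h] using this

lemma tendsto_poch_mul_rGamma_of_add_eq₃ {z w u z' w' u' : ℂ} (h : z + w + u = z' + w' + u') :
    Tendsto (fun n : ℕ => poch z n * poch w n * poch u n *
      (rGamma (z' + n) * rGamma (w' + n) * rGamma (u' + n)))
      atTop (𝓝 (rGamma z * rGamma w * rGamma u)) := by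
  have h1 := (tendsto_poch_mul_rGamma (z := z) (w := w) (z' := z') (w' := w')).mul
    ((tendsto_poch_div_gammaScale u).mul (tendsto_rGamma_mul_gammaScale u'))
  rw [mul_one] at h1
  refine h1.congr' ?_
  filter_upwards [eventually_ne_atTop 0] with n hn
  have hn' : (n : ℂ) ≠ 0 := by exact_mod_cast hn
  have hu := gammaScale_ne_zero u hn
  have key : gammaScale u n = (n : ℂ) ^ (z' + w' - z - w) * gammaScale u' n := by
    rw [gammaScale, gammaScale, ← mul_assoc, ← Complex.cpow_add _ _ hn']
    congr 2
    linear_combination h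
  have h2 : (n : ℂ) ^ (z' + w' - z - w) * gammaScale u' n / gammaScale u n = 1 := by
    rw [← key, div_self hu]
  linear_combination poch z n * poch w n * poch u n *
      (rGamma (z' + n) * rGamma (w' + n) * rGamma (u' + n)) * h2

lemma rGamma_one_add_nat (n : ℕ) : rGamma (1 + n) = (n.factorial : ℂ)⁻¹ := by
  rw [rGamma, add_comm, Complex.Gamma_nat_eq_factorial]

lemma poch_succ' (z : ℂ) (n : ℕ) : poch z (n + 1) = z * poch (z + 1) n := by
  rw [poch, Finset.prod_range_succ', poch, mul_comm]
  simp only [Nat.cast_zero, add_zero]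
  congr 1
  refine Finset.prod_congr rfl fun i _ => ?_
  push_cast
  ring

section Raabe

variable {δ : ℝ} {K : ℕ}

lemma norm_mul_rpow_le_of_raabe {u : ℕ → ℂ}
    (h : ∀ k, K ≤ k → ‖u (k + 1)‖ * ((k + 1 : ℕ) : ℝ) ^ (1 + δ) ≤ ‖u k‖ * (k : ℝ) ^ (1 + δ))
    {k : ℕ} (hk : K ≤ k) : ‖u k‖ * (k : ℝ) ^ (1 + δ) ≤ ‖u K‖ * (K : ℝ) ^ (1 + δ) := by
  induction k, hk using Nat.le_induction with
  | base => exact le_rfl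
  | succ k hk ih => exact (h k hk).trans ih

lemma tendsto_tsum_of_raabe {ι : Type*} {l : Filter ι} {u : ι → ℕ → ℂ} {v : ℕ → ℂ}
    (hδ : 0 < δ) (hK : 0 < K) (hlim : ∀ k, Tendsto (fun i => u i k) l (𝓝 (v k)))
    (h : ∀ᶠ i in l, ∀ k, K ≤ k →
      ‖u i (k + 1)‖ * ((k + 1 : ℕ) : ℝ) ^ (1 + δ) ≤ ‖u i k‖ * (k : ℝ) ^ (1 + δ)) :
    Tendsto (fun i => ∑' k, u i k) l (𝓝 (∑' k, v k)) := by
  set bound : ℕ → ℝ := fun k => if k < K then ‖v k‖ + 1 else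
    (‖v K‖ + 1) * (K : ℝ) ^ (1 + δ) * ((k : ℝ) ^ (1 + δ))⁻¹ with hbound
  have hs : Summable bound := by
    have h1 : Summable fun k : ℕ => (‖v K‖ + 1) * (K : ℝ) ^ (1 + δ) * ((k : ℝ) ^ (1 + δ))⁻¹ :=
      (Real.summable_nat_rpow_inv.mpr (by linarith)).mul_left _
    rw [← summable_nat_add_iff K] at h1 ⊢
    refine h1.congr fun k => ?_
    simp [hbound]
  refine tendsto_tsum_of_dominated_convergence hs hlim ?_
  have hfin : ∀ᶠ i in l, ∀ k ∈ Finset.range (K + 1), ‖u i k‖ ≤ ‖v k‖ + 1 :=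
    (Finset.eventually_all _).mpr fun k _ =>
      ((hlim k).norm.eventually_lt_const (by linarith)).mono fun _ => le_of_lt
  filter_upwards [hfin, h] with i hi hr k
  simp only [hbound]
  split_ifs with hk
  · exact hi k (by simp; omega)
  · have hk0 : (0 : ℝ) < k := by exact_mod_cast (by omega : 0 < k)
    have := norm_mul_rpow_le_of_raabe hr (not_lt.mp hk)
    rw [← div_eq_mul_inv, le_div_iff₀ (by positivity)]
    exact this.trans (by gcongr; exact hi K (by simp))

lemma summable_norm_of_raabe {u : ℕ → ℂ} (hδ : 0 < δ) (hK : 0 < K)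
    (h : ∀ k, K ≤ k → ‖u (k + 1)‖ * ((k + 1 : ℕ) : ℝ) ^ (1 + δ) ≤ ‖u k‖ * (k : ℝ) ^ (1 + δ)) :
    Summable fun k => ‖u k‖ := by
  have h1 : Summable fun k : ℕ => ‖u K‖ * (K : ℝ) ^ (1 + δ) * ((k : ℝ) ^ (1 + δ))⁻¹ :=
    (Real.summable_nat_rpow_inv.mpr (by linarith)).mul_left _
  rw [← summable_nat_add_iff K] at h1 ⊢
  refine Summable.of_nonneg_of_le (fun _ => norm_nonneg _) (fun k => ?_) h1
  have hk0 : (0 : ℝ) < (k + K : ℕ) := by exact_mod_cast (by omega : 0 < k + K)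
  rw [← div_eq_mul_inv, le_div_iff₀ (by positivity)]
  exact norm_mul_rpow_le_of_raabe h (by omega)

end Raabe

lemma norm_mul_le_of_mul_eq_mul {x x' N D : ℂ} {p p' : ℝ} (hD : D ≠ 0)
    (h : x' * D = x * N) (hle : ‖N‖ * p' ≤ ‖D‖ * p) : ‖x'‖ * p' ≤ ‖x‖ * p := by
  have hD' : 0 < ‖D‖ := norm_pos_iff.mpr hD
  have h2 : ‖x'‖ * ‖D‖ = ‖x‖ * ‖N‖ := by rw [← norm_mul, h, norm_mul]
  refine le_of_mul_le_mul_right ?_ hD'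
  calc ‖x'‖ * p' * ‖D‖ = ‖x‖ * (‖N‖ * p') := by linear_combination p' * h2
    _ ≤ ‖x‖ * (‖D‖ * p) := by gcongr
    _ = _ := by ring

/-- The `k`-th term of the regularized series `₃F₂(a, b, c; e, f; 1) / (Γ(e) Γ(f))`. -/
noncomputable def hypTerm (a b c e f : ℂ) (k : ℕ) : ℂ :=
  poch a k * poch b k * poch c k * (rGamma (e + k) * rGamma (f + k)) / (k.factorial : ℂ)

/-- The `k`-th term of the regularized series `₂F₁(a, b; e; 1) / Γ(e)`. -/
noncomputable def gaussTerm (a b e : ℂ) (k : ℕ) : ℂ :=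
  poch a k * poch b k * rGamma (e + k) / (k.factorial : ℂ)

lemma one_add_nat_ne_zero (k : ℕ) : (1 + k : ℂ) ≠ 0 := by
  rw [add_comm]; exact Nat.cast_add_one_ne_zero k

lemma hypTerm_succ (a b c e f : ℂ) (k : ℕ) :
    hypTerm a b c e f (k + 1) * ((e + k) * (f + k) * (1 + k)) =
      hypTerm a b c e f k * ((a + k) * (b + k) * (c + k)) := by
  have h1 := one_add_nat_ne_zero k
  have h2 : (k.factorial : ℂ) ≠ 0 := by exact_mod_cast k.factorial_ne_zero
  simp only [hypTerm, poch_succ, Nat.factorial_succ, rGamma_eq_mul (e + k), rGamma_eq_mul (f + k)]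
  push_cast
  rw [add_comm (k : ℂ) 1, show e + (1 + (k : ℂ)) = e + k + 1 by ring,
    show f + (1 + (k : ℂ)) = f + k + 1 by ring]
  field_simp

lemma gaussTerm_succ (a b e : ℂ) (k : ℕ) :
    gaussTerm a b e (k + 1) * ((e + k) * (1 + k)) =
      gaussTerm a b e k * ((a + k) * (b + k)) := by
  have h1 := one_add_nat_ne_zero k
  have h2 : (k.factorial : ℂ) ≠ 0 := by exact_mod_cast k.factorial_ne_zero
  simp only [gaussTerm, poch_succ, Nat.factorial_succ, rGamma_eq_mul (e + k)]
  push_cast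
  rw [add_comm (k : ℂ) 1, show e + (1 + (k : ℂ)) = e + k + 1 by ring]
  field_simp

lemma summable_norm_hypTerm {a b c e f : ℂ} (h : a.re + b.re + c.re < e.re + f.re) :
    Summable fun k => ‖hypTerm a b c e f k‖ := by
  obtain ⟨K, hK, hB⟩ := exists_raabe_bound (‖a‖ + ‖b‖ + ‖c‖ + ‖e‖ + ‖f‖)
    ((e.re + f.re - a.re - b.re - c.re) / 2) (by linarith)
  have := norm_nonneg a
  have := norm_nonneg b
  have := norm_nonneg c
  have := norm_nonneg e
  have := norm_nonneg f
  refine summable_norm_of_raabe (δ := (e.re + f.re - a.re - b.re - c.re) / 2) (by linarith) hK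
    fun k hk => ?_
  obtain ⟨he, hf, hle⟩ := hB a b c e f (by linarith) (by linarith) (by linarith) (by linarith)
    (by linarith) (by linarith) k hk
  exact norm_mul_le_of_mul_eq_mul (mul_ne_zero (mul_ne_zero he hf) (one_add_nat_ne_zero k))
    (hypTerm_succ a b c e f k) hle

lemma exists_raabe_bound_gauss {a b e : ℂ} (h : a.re + b.re < e.re) :
    ∃ δ : ℝ, 0 < δ ∧ ∃ K : ℕ, 0 < K ∧ ∀ k : ℕ, K ≤ k → e + k ≠ 0 ∧
      ‖(a + k) * (b + k)‖ * ((k + 1 : ℕ) : ℝ) ^ (1 + δ) ≤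
        ‖(e + k) * (1 + k)‖ * (k : ℝ) ^ (1 + δ) := by
  obtain ⟨K, hK, hB⟩ := exists_raabe_bound (‖a‖ + ‖b‖ + ‖e‖)
    ((e.re - a.re - b.re) / 2) (by linarith)
  refine ⟨(e.re - a.re - b.re) / 2, by linarith, K, hK, fun k hk => ?_⟩
  have := norm_nonneg a
  have := norm_nonneg b
  have := norm_nonneg e
  obtain ⟨he, -, hle⟩ := hB a b e e e (by linarith) (by linarith) (by linarith) (by linarith)
    (by linarith) (by linarith) k hk
  refine ⟨he, ?_⟩
  have he' : 0 < ‖e + k‖ := norm_pos_iff.mpr he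
  refine le_of_mul_le_mul_right ?_ he'
  rw [norm_mul, norm_mul] at hle ⊢
  rw [norm_mul, norm_mul] at hle
  linarith

lemma summable_norm_gaussTerm {a b e : ℂ} (h : a.re + b.re < e.re) :
    Summable fun k => ‖gaussTerm a b e k‖ := by
  obtain ⟨δ, hδ, K, hK, hB⟩ := exists_raabe_bound_gauss h
  refine summable_norm_of_raabe hδ hK fun k hk => ?_
  obtain ⟨he, hle⟩ := hB k hk
  exact norm_mul_le_of_mul_eq_mul (mul_ne_zero he (one_add_nat_ne_zero k))
    (gaussTerm_succ a b e k) hle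

lemma tendsto_natCast_cpow_zero {s : ℂ} (hs : s.re < 0) :
    Tendsto (fun n : ℕ => (n : ℂ) ^ s) atTop (𝓝 0) := by
  rw [tendsto_zero_iff_norm_tendsto_zero]
  have h := (tendsto_rpow_neg_atTop (y := -s.re) (by linarith)).comp
    (tendsto_natCast_atTop_atTop (R := ℝ))
  refine h.congr' ?_
  filter_upwards [eventually_gt_atTop 0] with n hn
  rw [Complex.norm_natCast_cpow_of_pos hn]
  simp

lemma gauss_contiguous {a b e : ℂ} (h : a.re + b.re < e.re) :
    (e - a - b) * ∑' k, gaussTerm a b e k =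
      (e - a) * (e - b) * ∑' k, gaussTerm a b (e + 1) k := by
  have s1 := (summable_norm_gaussTerm h).of_norm.hasSum.mul_left (e - a - b)
  have s2 := (summable_norm_gaussTerm (a := a) (b := b) (e := e + 1)
    (by simp; linarith)).of_norm.hasSum.mul_left ((e - a) * (e - b))
  have hs := (s1.sub s2).tendsto_sum_nat.comp (tendsto_add_atTop_nat 1)
  have hsum : ∀ n : ℕ, ∑ k ∈ Finset.range (n + 1), ((e - a - b) * gaussTerm a b e k -
      (e - a) * (e - b) * gaussTerm a b (e + 1) k) =
      -(poch a (n + 1) * poch b (n + 1) * rGamma (e + 1 + n) / (n.factorial : ℂ)) := by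
    intro n
    induction n with
    | zero =>
      simp [gaussTerm, rGamma_eq_mul e, poch_succ]
      ring
    | succ n ih =>
      rw [Finset.sum_range_succ, ih]
      have h1 := Nat.cast_add_one_ne_zero (R := ℂ) n
      have h2 : (n.factorial : ℂ) ≠ 0 := by exact_mod_cast n.factorial_ne_zero
      simp only [gaussTerm, poch_succ, Nat.factorial_succ, rGamma_eq_mul (e + (n + 1 : ℕ)),
        rGamma_eq_mul (e + 1 + n)]
      push_cast
      rw [show e + ((n : ℂ) + 1) + 1 = e + n + 2 by ring,
        show e + 1 + (n : ℂ) + 1 = e + n + 2 by ring,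
        show e + 1 + ((n : ℂ) + 1) = e + n + 2 by ring]
      field_simp
      ring
  have hlim : Tendsto (fun n : ℕ =>
      -(poch a (n + 1) * poch b (n + 1) * rGamma (e + 1 + n) / (n.factorial : ℂ)))
      atTop (𝓝 0) := by
    have h1 := (tendsto_poch_mul_rGamma (z := a + 1) (w := b + 1) (z' := e + 1) (w' := 1)).mul
      (tendsto_natCast_cpow_zero (s := a + b - e) (by simp; linarith)) |>.const_mul (-(a * b))
    rw [mul_zero, mul_zero] at h1
    refine h1.congr' ?_
    filter_upwards [eventually_ne_atTop 0] with n hn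
    have hn' : (n : ℂ) ≠ 0 := by exact_mod_cast hn
    have h2 : (n : ℂ) ^ (e + 1 + 1 - (a + 1) - (b + 1)) * (n : ℂ) ^ (a + b - e) = 1 := by
      rw [← Complex.cpow_add _ _ hn', show e + 1 + 1 - (a + 1) - (b + 1) + (a + b - e) = 0 by ring,
        Complex.cpow_zero]
    rw [rGamma_one_add_nat, poch_succ', poch_succ']
    linear_combination (-(a * b)) *
      (poch (a + 1) n * poch (b + 1) n * rGamma (e + 1 + n) / (n.factorial : ℂ)) * h2
  have := tendsto_nhds_unique (hlim.congr fun n => (hsum n).symm) hs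
  linear_combination -this

lemma gauss_iterate {a b e : ℂ} (h : a.re + b.re < e.re) (n : ℕ) :
    poch (e - a - b) n * ∑' k, gaussTerm a b e k =
      poch (e - a) n * poch (e - b) n * ∑' k, gaussTerm a b (e + n) k := by
  induction n with
  | zero => simp
  | succ n ih =>
    have := gauss_contiguous (a := a) (b := b) (e := e + n) (by
      simp; linarith [(Nat.cast_nonneg n : (0 : ℝ) ≤ n)])
    simp only [poch_succ]
    push_cast
    rw [← add_assoc]
    linear_combination (e - a - b + n) * ih + poch (e - a) n * poch (e - b) n * this

lemma tendsto_inv_add_nat_add (z w : ℂ) :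
    Tendsto (fun n : ℕ => (z + n + w)⁻¹) atTop (𝓝 0) := by
  have h := ((tendsto_add_nat_div_nat (z + w)).inv₀ one_ne_zero).mul
    (tendsto_inv_atTop_nhds_zero_nat (𝕜 := ℂ))
  rw [mul_zero] at h
  refine h.congr' ?_
  filter_upwards [eventually_ne_atTop 0] with n hn
  have hn' : (n : ℂ) ≠ 0 := by exact_mod_cast hn
  rw [inv_div, show z + n + w = z + w + n by ring]
  field_simp

lemma tsum_gaussTerm {a b e : ℂ} (h : a.re + b.re < e.re) :
    ∑' k, gaussTerm a b e k =
      Complex.Gamma (e - a - b) * (rGamma (e - a) * rGamma (e - b)) := by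
  have hs : ∀ m : ℕ, e - a - b ≠ -(m : ℂ) := by
    intro m hm
    have := congrArg Complex.re hm
    simp at this
    linarith [(Nat.cast_nonneg m : (0 : ℝ) ≤ m)]
  obtain ⟨δ, hδ, K, hK, hB⟩ := exists_raabe_bound_gauss h
  obtain ⟨N, hN⟩ := exists_nat_gt (2 * |e.re|)
  set u : ℕ → ℕ → ℂ := fun n k => poch a k * poch b k / (poch (e + n) k * (k.factorial : ℂ))
    with hu
  have hre : ∀ n, N ≤ n → ∀ k : ℕ, e + n + k ≠ 0 ∧ ‖e + k‖ ≤ ‖e + n + k‖ := by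
    intro n hn k
    have hn' : (N : ℝ) ≤ n := by exact_mod_cast hn
    have hk : (0 : ℝ) ≤ k := Nat.cast_nonneg k
    have := neg_abs_le e.re
    have := abs_nonneg e.re
    constructor
    · intro h0
      have := congrArg Complex.re h0
      simp at this
      linarith
    · rw [← sq_le_sq₀ (norm_nonneg _) (norm_nonneg _), ← Complex.normSq_eq_norm_sq,
        ← Complex.normSq_eq_norm_sq, Complex.normSq_apply, Complex.normSq_apply]
      simp
      nlinarith
  have hT : Tendsto (fun n => ∑' k, u n k) atTop (𝓝 (∑' k, if k = 0 then (1 : ℂ) else 0)) := by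
    refine tendsto_tsum_of_raabe hδ hK (fun k => ?_) ?_
    · cases k with
      | zero => simp [hu]
      | succ k =>
        simp only [Nat.add_eq_zero_iff, one_ne_zero, and_false, if_false]
        have h1 : Tendsto (fun n : ℕ => ∏ i ∈ Finset.range (k + 1), (e + n + i)⁻¹) atTop
            (𝓝 (∏ _i ∈ Finset.range (k + 1), (0 : ℂ))) :=
          tendsto_finsetProd _ fun i _ => tendsto_inv_add_nat_add e i
        have h2 := h1.const_mul (poch a (k + 1) * poch b (k + 1) / ((k + 1).factorial : ℂ))
        rw [Finset.prod_const, Finset.card_range, zero_pow k.succ_ne_zero, mul_zero] at h2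
        refine h2.congr fun n => ?_
        rw [Finset.prod_inv_distrib]
        simp only [hu]
        rw [poch.eq_1 (e + n)]
        field_simp
    · filter_upwards [eventually_ge_atTop N] with n hn k hk
      obtain ⟨he, hle⟩ := hB k hk
      obtain ⟨h0, hle'⟩ := hre n hn k
      have hp : ∀ j, poch (e + n) j ≠ 0 := fun j =>
        Finset.prod_ne_zero_iff.mpr fun i _ => (hre n hn i).1
      refine norm_mul_le_of_mul_eq_mul (N := (a + k) * (b + k)) (D := (e + n + k) * (1 + k))
        (mul_ne_zero h0 (one_add_nat_ne_zero k)) ?_ (hle.trans ?_)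
      · have h1 := one_add_nat_ne_zero k
        have h2 : (k.factorial : ℂ) ≠ 0 := by exact_mod_cast k.factorial_ne_zero
        have h3 := hp k
        simp only [hu, poch_succ, Nat.factorial_succ]
        push_cast
        rw [add_comm (k : ℂ) 1]
        field_simp
      · rw [norm_mul, norm_mul]
        gcongr
  rw [tsum_ite_eq] at hT
  have hP := (tendsto_poch_mul_rGamma_of_add_eq (z := e - a) (w := e - b) (z' := e)
    (w' := e - a - b) (by ring)).mul hT |>.const_mul (Complex.Gamma (e - a - b))
  rw [mul_one] at hP
  refine tendsto_nhds_unique (tendsto_const_nhds.congr' ?_) hP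
  filter_upwards [eventually_ge_atTop N] with n hn
  have e1 : ∑' k, gaussTerm a b (e + n) k = rGamma (e + n) * ∑' k, u n k := by
    rw [← tsum_mul_left]
    refine tsum_congr fun k => ?_
    have hp : poch (e + n) k ≠ 0 := Finset.prod_ne_zero_iff.mpr fun i _ => (hre n hn i).1
    simp only [gaussTerm, hu]
    rw [← poch_mul_rGamma_add (e + n) k]
    field_simp
  have e2 := gauss_iterate h n
  have e3 := poch_mul_rGamma_add (e - a - b) n
  have e4 : Complex.Gamma (e - a - b) * rGamma (e - a - b) = 1 :=
    mul_inv_cancel₀ (Complex.Gamma_ne_zero hs)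
  rw [e1] at e2
  linear_combination (-(Complex.Gamma (e - a - b)) * rGamma (e - a - b + n)) * (-e2) +
    (-(Complex.Gamma (e - a - b)) * e3 - e4) * ∑' k, gaussTerm a b e k

lemma hypTerm_contiguous {a b c e f : ℂ} (hf : f = a + b + c - e + 1) :
    (c - e + 1) * ∑' k, hypTerm a b c e f k -
      (f - a) * (f - b) * ∑' k, hypTerm a b (c + 1) e (f + 1) k =
      -(rGamma a * rGamma b * rGamma (c + 1)) := by
  have hre : f.re = a.re + b.re + c.re - e.re + 1 := by simp [hf]
  have s1 := (summable_norm_hypTerm (a := a) (b := b) (c := c) (e := e) (f := f)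
    (by linarith)).of_norm.hasSum.mul_left (c - e + 1)
  have s2 := (summable_norm_hypTerm (a := a) (b := b) (c := c + 1) (e := e) (f := f + 1)
    (by simp; linarith)).of_norm.hasSum.mul_left ((f - a) * (f - b))
  have hs := (s1.sub s2).tendsto_sum_nat.comp (tendsto_add_atTop_nat 1)
  have hsum : ∀ n : ℕ, ∑ k ∈ Finset.range (n + 1), ((c - e + 1) * hypTerm a b c e f k -
      (f - a) * (f - b) * hypTerm a b (c + 1) e (f + 1) k) =
      -(poch a (n + 1) * poch b (n + 1) * poch (c + 1) n *
        (rGamma (e + n) * rGamma (f + 1 + n)) / (n.factorial : ℂ)) := by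
    intro n
    induction n with
    | zero =>
      simp [hypTerm, rGamma_eq_mul f, poch_succ]
      rw [hf]
      ring
    | succ n ih =>
      rw [Finset.sum_range_succ, ih]
      have h1 := Nat.cast_add_one_ne_zero (R := ℂ) n
      have h2 : (n.factorial : ℂ) ≠ 0 := by exact_mod_cast n.factorial_ne_zero
      simp only [hypTerm, poch_succ' c, poch_succ, Nat.factorial_succ,
        rGamma_eq_mul (f + (n + 1 : ℕ)), rGamma_eq_mul (f + 1 + n), rGamma_eq_mul (e + n)]
      push_cast
      rw [show f + ((n : ℂ) + 1) + 1 = f + n + 2 by ring,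
        show f + 1 + (n : ℂ) + 1 = f + n + 2 by ring,
        show f + 1 + ((n : ℂ) + 1) = f + n + 2 by ring,
        show e + ((n : ℂ) + 1) = e + n + 1 by ring]
      generalize rGamma (f + n + 2) = F
      generalize rGamma (e + n + 1) = G
      subst hf
      field_simp
      ring
  have hlim : Tendsto (fun n : ℕ => -(poch a (n + 1) * poch b (n + 1) * poch (c + 1) n *
        (rGamma (e + n) * rGamma (f + 1 + n)) / (n.factorial : ℂ)))
      atTop (𝓝 (-(rGamma a * rGamma b * rGamma (c + 1)))) := by
    have h1 := (tendsto_poch_mul_rGamma_of_add_eq₃ (z := a + 1) (w := b + 1) (u := c + 1)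
      (z' := e) (w' := f + 1) (u' := 1) (by rw [hf]; ring)).const_mul (-(a * b))
    rw [show -(a * b) * (rGamma (a + 1) * rGamma (b + 1) * rGamma (c + 1)) =
      -(rGamma a * rGamma b * rGamma (c + 1)) by
        rw [rGamma_eq_mul a, rGamma_eq_mul b]; ring] at h1
    refine h1.congr fun n => ?_
    rw [rGamma_one_add_nat, poch_succ', poch_succ']
    ring
  exact (tendsto_nhds_unique (hlim.congr fun n => (hsum n).symm) hs).symm

/-- The left-hand side of the nonterminating Saalschütz identity, regularized to be entire in
the numerator parameters. -/
noncomputable def saalschutzSum (a b c e f : ℂ) : ℂ :=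
  rGamma (a - e + 1) * rGamma (b - e + 1) * rGamma (c - e + 1) * ∑' k, hypTerm a b c e f k -
    rGamma a * rGamma b * rGamma c *
      ∑' k, hypTerm (a - e + 1) (b - e + 1) (c - e + 1) (2 - e) (f - e + 1) k

lemma saalschutzSum_eq_mul {a b c e f : ℂ} (hf : f = a + b + c - e + 1) :
    saalschutzSum a b c e f = (f - a) * (f - b) * saalschutzSum a b (c + 1) e (f + 1) := by
  have h1 := hypTerm_contiguous hf
  have h2 := hypTerm_contiguous (a := a - e + 1) (b := b - e + 1) (c := c - e + 1) (e := 2 - e)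
    (f := f - e + 1) (by rw [hf]; ring)
  rw [show c - e + 1 - (2 - e) + 1 = c by ring, show f - e + 1 - (a - e + 1) = f - a by ring,
    show f - e + 1 - (b - e + 1) = f - b by ring] at h2
  rw [saalschutzSum, saalschutzSum, show c + 1 - e + 1 = c - e + 1 + 1 by ring,
    show f + 1 - e + 1 = f - e + 1 + 1 by ring, rGamma_eq_mul (c - e + 1), rGamma_eq_mul c]
  linear_combination rGamma (a - e + 1) * rGamma (b - e + 1) * rGamma (c - e + 1 + 1) * h1 -
    rGamma a * rGamma b * rGamma (c + 1) * h2

lemma saalschutzSum_iterate {a b c e f : ℂ} (hf : f = a + b + c - e + 1) (n : ℕ) :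
    saalschutzSum a b c e f =
      poch (f - a) n * poch (f - b) n * saalschutzSum a b (c + n) e (f + n) := by
  induction n with
  | zero => simp
  | succ n ih =>
    rw [ih, saalschutzSum_eq_mul (a := a) (b := b) (c := c + n) (by rw [hf]; ring), poch_succ,
      poch_succ]
    push_cast
    rw [← add_assoc, ← add_assoc]
    ring

lemma eventually_norm_add_le {s : ℂ} (hs : 0 < s.re) (c : ℂ) :
    ∀ᶠ n : ℕ in atTop, ‖c + n‖ ≤ ‖c + s + n‖ := by
  obtain ⟨N, hN⟩ := exists_nat_gt (|c.im * s.im| / s.re - c.re)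
  filter_upwards [eventually_ge_atTop N] with n hn
  have hn' : (N : ℝ) ≤ n := by exact_mod_cast hn
  have h1 : |c.im * s.im| ≤ (n + c.re) * s.re := by
    rw [← div_le_iff₀ hs]; linarith
  have h2 := neg_abs_le (c.im * s.im)
  rw [← sq_le_sq₀ (norm_nonneg _) (norm_nonneg _), ← Complex.normSq_eq_norm_sq,
    ← Complex.normSq_eq_norm_sq, Complex.normSq_apply, Complex.normSq_apply]
  simp
  nlinarith [mul_self_nonneg s.re, mul_self_nonneg s.im]

lemma tendsto_poch_add_div (c f : ℂ) (k : ℕ) :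
    Tendsto (fun n : ℕ => poch (c + n) k / poch (f + n) k) atTop (𝓝 1) := by
  have h : Tendsto (fun n : ℕ => ∏ i ∈ Finset.range k, ((c + n + i) / (f + n + i))) atTop
      (𝓝 (∏ _i ∈ Finset.range k, (1 : ℂ))) := by
    refine tendsto_finsetProd _ fun i _ => ?_
    have := (tendsto_add_nat_div_nat (c + i)).div (tendsto_add_nat_div_nat (f + i)) one_ne_zero
    rw [div_one] at this
    refine this.congr' ?_
    filter_upwards [eventually_ne_atTop 0] with n hn
    have hn' : (n : ℂ) ≠ 0 := by exact_mod_cast hn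
    simp only [Pi.div_apply]
    rw [div_div_div_cancel_right₀ hn', add_right_comm, add_right_comm f]
  rw [Finset.prod_const_one] at h
  refine h.congr fun n => ?_
  rw [Finset.prod_div_distrib, poch, poch]

lemma tendsto_poch_mul_tsum_hypTerm {a b c e f d : ℂ} (hf : f = a + b + c - e + 1)
    (hd : d = a + b - e + 1) (hd0 : 0 < d.re) (hd1 : d.re < 1) {z w u : ℂ}
    (h : z + w = u + f) :
    Tendsto (fun n : ℕ => poch z n * poch w n * rGamma (u + n) *
      ∑' k, hypTerm a b (c + n) e (f + n) k) atTop
      (𝓝 (rGamma z * rGamma w * ∑' k, gaussTerm a b e k)) := by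
  have hre : d.re = a.re + b.re - e.re + 1 := by simp [hd]
  obtain ⟨δ, hδ, K, hK, hB⟩ := exists_raabe_bound_gauss (a := a) (b := b) (e := e) (by linarith)
  obtain ⟨N₁, hN₁⟩ := eventually_atTop.mp (eventually_norm_add_le hd0 c)
  obtain ⟨N₂, hN₂⟩ := exists_nat_gt (-f.re)
  have hfc : f = c + d := by rw [hf, hd]; ring
  have hne : ∀ n, N₂ ≤ n → ∀ k : ℕ, f + n + k ≠ 0 := by
    intro n hn k h0
    have hn' : (N₂ : ℝ) ≤ n := by exact_mod_cast hn
    have := congrArg Complex.re h0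
    simp at this
    linarith [(Nat.cast_nonneg k : (0 : ℝ) ≤ k)]
  set u' : ℕ → ℕ → ℂ := fun n k => gaussTerm a b e k * (poch (c + n) k / poch (f + n) k) with hu
  have hT : Tendsto (fun n => ∑' k, u' n k) atTop (𝓝 (∑' k, gaussTerm a b e k)) := by
    refine tendsto_tsum_of_raabe hδ hK (fun k => ?_) ?_
    · simpa using (tendsto_poch_add_div c f k).const_mul (gaussTerm a b e k)
    · filter_upwards [eventually_ge_atTop N₁, eventually_ge_atTop N₂] with n hn₁ hn₂ k hk
      obtain ⟨he, hle⟩ := hB k hk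
      have h0 := hne n hn₂ k
      have hp : poch (f + n) k ≠ 0 := Finset.prod_ne_zero_iff.mpr fun i _ => hne n hn₂ i
      refine norm_mul_le_of_mul_eq_mul (N := (a + k) * (b + k) * (c + n + k))
        (D := (e + k) * (1 + k) * (f + n + k))
        (mul_ne_zero (mul_ne_zero he (one_add_nat_ne_zero k)) h0) ?_ ?_
      · simp only [hu, poch_succ]
        have := gaussTerm_succ a b e k
        field_simp
        linear_combination (c + n + k) * poch (c + n) k * this
      · have h1 := hN₁ (n + k) (by omega)
        rw [← hfc] at h1
        push_cast at h1
        rw [← add_assoc, ← add_assoc] at h1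
        rw [norm_mul, norm_mul _ (f + n + k)]
        calc _ = ‖(a + k) * (b + k)‖ * ((k + 1 : ℕ) : ℝ) ^ (1 + δ) * ‖c + n + k‖ := by ring
          _ ≤ ‖(e + k) * (1 + k)‖ * (k : ℝ) ^ (1 + δ) * ‖f + n + k‖ := by gcongr
          _ = _ := by ring
  refine ((tendsto_poch_mul_rGamma_of_add_eq h).mul hT).congr' ?_
  filter_upwards [eventually_ge_atTop N₂] with n hn
  have e1 : ∑' k, hypTerm a b (c + n) e (f + n) k = rGamma (f + n) * ∑' k, u' n k := by
    rw [← tsum_mul_left]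
    refine tsum_congr fun k => ?_
    have hp : poch (f + n) k ≠ 0 := Finset.prod_ne_zero_iff.mpr fun i _ => hne n hn i
    simp only [hypTerm, hu, gaussTerm]
    rw [← poch_mul_rGamma_add (f + n) k]
    field_simp
  rw [e1]
  ring

/-- The regularized right-hand side of the nonterminating Saalschütz identity. -/
noncomputable def saalschutzProd (a b c e f : ℂ) : ℂ :=
  rGamma e * rGamma (1 - e) * (rGamma (f - a) * rGamma (f - b) * rGamma (f - c))

lemma saalschutz_of_re_mem_Ioo {a b c e f : ℂ} (hf : f = a + b + c - e + 1)
    (h0 : 0 < (f - c).re) (h1 : (f - c).re < 1) :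
    saalschutzSum a b c e f = saalschutzProd a b c e f := by
  have hd : f - c = a + b - e + 1 := by rw [hf]; ring
  have hd' : f - c = (a - e + 1) + (b - e + 1) - (2 - e) + 1 := by rw [hf]; ring
  have hre : (f - c).re = a.re + b.re - e.re + 1 := by simp [hd]
  have t1 := tendsto_poch_mul_tsum_hypTerm (a := a) (b := b) (c := c) (e := e) hf hd h0 h1
    (z := f - a) (w := f - b) (u := c - e + 1) (by rw [hf]; ring)
  have t2 := tendsto_poch_mul_tsum_hypTerm (a := a - e + 1) (b := b - e + 1) (c := c - e + 1)
    (e := 2 - e) (f := f - e + 1) (by rw [hf]; ring) hd' h0 h1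
    (z := f - a) (w := f - b) (u := c) (by rw [hf]; ring)
  have t := (t1.const_mul (rGamma (a - e + 1) * rGamma (b - e + 1))).sub
    (t2.const_mul (rGamma a * rGamma b))
  have hc := t.congr (f₂ := fun _ : ℕ => saalschutzSum a b c e f) fun n => by
    rw [saalschutzSum_iterate hf n, saalschutzSum, show c + n - e + 1 = c - e + 1 + n by ring,
      show f + n - e + 1 = f - e + 1 + n by ring]
    ring
  have key := tendsto_nhds_unique tendsto_const_nhds hc
  rw [key, tsum_gaussTerm (by linarith), tsum_gaussTerm (by simp; linarith), saalschutzProd,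
    show 2 - e - (a - e + 1) - (b - e + 1) = e - a - b by ring,
    show 2 - e - (a - e + 1) = 1 - a by ring, show 2 - e - (b - e + 1) = 1 - b by ring,
    show f - c = 1 - (e - a - b) by rw [hd]; ring,
    show a - e + 1 = 1 - (e - a) by ring, show b - e + 1 = 1 - (e - b) by ring]
  have hs : ∀ m : ℕ, e - a - b ≠ -(m : ℂ) := by
    intro m hm
    have := congrArg Complex.re hm
    simp at this
    linarith [(Nat.cast_nonneg m : (0 : ℝ) ≤ m)]
  have hG : Complex.Gamma (e - a - b) * rGamma (e - a - b) = 1 :=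
    mul_inv_cancel₀ (Complex.Gamma_ne_zero hs)
  have hπ : (Real.pi : ℂ) ≠ 0 := by exact_mod_cast Real.pi_ne_zero
  have r1 := rGamma_mul_rGamma_one_sub (e - a)
  have r2 := rGamma_mul_rGamma_one_sub (e - b)
  have r3 := rGamma_mul_rGamma_one_sub a
  have r4 := rGamma_mul_rGamma_one_sub b
  have r5 := rGamma_mul_rGamma_one_sub e
  have r6 := rGamma_mul_rGamma_one_sub (e - a - b)
  have trig : Complex.sin (Real.pi * (e - a)) * Complex.sin (Real.pi * (e - b)) -
      Complex.sin (Real.pi * a) * Complex.sin (Real.pi * b) =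
      Complex.sin (Real.pi * e) * Complex.sin (Real.pi * (e - a - b)) := by
    simp only [mul_sub, Complex.sin_sub, Complex.cos_sub]
    have p1 := Complex.sin_sq_add_cos_sq (Real.pi * e)
    linear_combination Complex.sin (Real.pi * a) * Complex.sin (Real.pi * b) * p1
  have main : rGamma (1 - (e - a)) * rGamma (1 - (e - b)) * (rGamma (e - a) * rGamma (e - b)) -
      rGamma a * rGamma b * (rGamma (1 - a) * rGamma (1 - b)) =
      rGamma e * rGamma (1 - e) * (rGamma (e - a - b) * rGamma (1 - (e - a - b))) := by
    rw [r5, r6]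
    calc _ = (rGamma (e - a) * rGamma (1 - (e - a))) * (rGamma (e - b) * rGamma (1 - (e - b))) -
          (rGamma a * rGamma (1 - a)) * (rGamma b * rGamma (1 - b)) := by ring
      _ = _ := by
        rw [r1, r2, r3, r4]
        field_simp
        linear_combination trig
  linear_combination (Complex.Gamma (e - a - b) * rGamma (f - a) * rGamma (f - b)) * main +
    rGamma e * rGamma (1 - e) * rGamma (1 - (e - a - b)) * rGamma (f - a) * rGamma (f - b) * hG

lemma hypTerm_comm₁₃ (a b c e f : ℂ) : hypTerm a b c e f = hypTerm c b a e f := by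
  funext k
  simp only [hypTerm]
  ring

lemma saalschutzSum_comm₁₃ (a b c e f : ℂ) :
    saalschutzSum a b c e f = saalschutzSum c b a e f := by
  rw [saalschutzSum, saalschutzSum, hypTerm_comm₁₃ a, hypTerm_comm₁₃ (a - e + 1)]
  ring

lemma saalschutz_add_one_iff {a b c e f : ℂ} (hf : f = a + b + c - e + 1) (hb : f - b ≠ 0)
    (hc : f - c ≠ 0) :
    saalschutzSum (a + 1) b c e (f + 1) = saalschutzProd (a + 1) b c e (f + 1) ↔
      saalschutzSum a b c e f = saalschutzProd a b c e f := by
  have h1 : saalschutzSum a b c e f =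
      (f - b) * (f - c) * saalschutzSum (a + 1) b c e (f + 1) := by
    rw [saalschutzSum_comm₁₃, saalschutzSum_eq_mul (by rw [hf]; ring), saalschutzSum_comm₁₃]
    ring
  have h2 : saalschutzProd a b c e f =
      (f - b) * (f - c) * saalschutzProd (a + 1) b c e (f + 1) := by
    rw [saalschutzProd, saalschutzProd, rGamma_eq_mul (f - b), rGamma_eq_mul (f - c),
      show f + 1 - (a + 1) = f - a by ring, show f + 1 - b = f - b + 1 by ring,
      show f + 1 - c = f - c + 1 by ring]
    ring
  rw [h1, h2]
  exact (mul_right_inj' (mul_ne_zero hb hc)).symm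

lemma saalschutz_add_intCast_iff {a b c e f : ℂ} (hf : f = a + b + c - e + 1)
    (hb : ∀ m : ℤ, f - b ≠ m) (hc : ∀ m : ℤ, f - c ≠ m) (m : ℤ) :
    saalschutzSum (a + m) b c e (f + m) = saalschutzProd (a + m) b c e (f + m) ↔
      saalschutzSum a b c e f = saalschutzProd a b c e f := by
  have step : ∀ m : ℤ,
      (saalschutzSum (a + (m + 1 : ℤ)) b c e (f + (m + 1 : ℤ)) =
        saalschutzProd (a + (m + 1 : ℤ)) b c e (f + (m + 1 : ℤ)) ↔
      saalschutzSum (a + m) b c e (f + m) = saalschutzProd (a + m) b c e (f + m)) := by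
    intro m
    push_cast
    rw [← add_assoc, ← add_assoc]
    refine saalschutz_add_one_iff (by rw [hf]; ring) (fun h => hb (-m) ?_) fun h => hc (-m) ?_ <;>
    · push_cast
      linear_combination h
  induction m with
  | zero => simp
  | succ m ih => exact (step m).trans ih
  | pred m ih =>
    have := step (-(m : ℤ) - 1)
    rw [sub_add_cancel] at this
    exact this.symm.trans ih

lemma saalschutz_of_not_int {a b c e f : ℂ} (hf : f = a + b + c - e + 1)
    (hb : ∀ m : ℤ, f - b ≠ m) (hc : ∀ m : ℤ, (f - c).re ≠ m) :
    saalschutzSum a b c e f = saalschutzProd a b c e f := by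
  rw [← saalschutz_add_intCast_iff hf hb (fun m h => hc m (by simp [h])) (-⌊(f - c).re⌋)]
  have h0 := Int.floor_le (f - c).re
  have h1 := Int.lt_floor_add_one (f - c).re
  have h2 := hc ⌊(f - c).re⌋
  have e1 : (f + ((-⌊(f - c).re⌋ : ℤ) : ℂ) - c).re = (f - c).re - ⌊(f - c).re⌋ := by
    simp only [Complex.sub_re, Complex.add_re, Complex.intCast_re]
    push_cast
    ring
  refine saalschutz_of_re_mem_Ioo (by rw [hf]; ring) ?_ ?_ <;> rw [e1]
  · exact sub_pos.mpr (lt_of_le_of_ne h0 h2.symm)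
  · linarith

lemma eventually_add_ne_intCast (x : ℝ) : ∀ᶠ t : ℝ in 𝓝[>] 0, ∀ m : ℤ, x + t ≠ m := by
  have h : 0 < ⌊x⌋ + 1 - x := by linarith [Int.lt_floor_add_one x]
  filter_upwards [Ioo_mem_nhdsGT h] with t ht m hm
  have h0 := Int.floor_le x
  have h1 : (⌊x⌋ : ℝ) < m := by linarith [ht.1]
  have h2 : (m : ℝ) < ⌊x⌋ + 1 := by linarith [ht.2]
  norm_cast at h1 h2
  omega

lemma continuous_poch (k : ℕ) : Continuous fun z => poch z k :=
  continuous_finsetProd _ fun _ _ => by fun_prop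

lemma tendsto_tsum_hypTerm_add {a b c e f : ℂ} (h : a.re + b.re + c.re < e.re + f.re) :
    Tendsto (fun t : ℝ => ∑' k, hypTerm (a + t) b c e (f + t) k) (𝓝[>] 0)
      (𝓝 (∑' k, hypTerm a b c e f k)) := by
  obtain ⟨K, hK, hB⟩ := exists_raabe_bound (‖a‖ + ‖b‖ + ‖c‖ + ‖e‖ + ‖f‖ + 1)
    ((e.re + f.re - a.re - b.re - c.re) / 2) (by linarith)
  have := norm_nonneg a
  have := norm_nonneg b
  have := norm_nonneg c
  have := norm_nonneg e
  have := norm_nonneg f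
  refine tendsto_tsum_of_raabe (δ := (e.re + f.re - a.re - b.re - c.re) / 2) (by linarith) hK
    (fun k => ?_) ?_
  · have hc : Continuous fun t : ℝ => hypTerm (a + t) b c e (f + t) k := by
      have h1 := (continuous_poch k).comp (by fun_prop : Continuous fun t : ℝ => a + (t : ℂ))
      have h2 := continuous_rGamma.comp (by fun_prop : Continuous fun t : ℝ => f + (t : ℂ) + k)
      simp only [Function.comp_def] at h1 h2
      unfold hypTerm
      fun_prop
    have := hc.tendsto 0
    simp only [Complex.ofReal_zero, add_zero] at this
    exact this.mono_left nhdsWithin_le_nhds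
  · filter_upwards [Ioo_mem_nhdsGT (zero_lt_one (α := ℝ))] with t ht k hk
    have hn : ‖(t : ℂ)‖ ≤ 1 := by
      rw [Complex.norm_real, Real.norm_eq_abs, abs_of_pos ht.1]
      exact ht.2.le
    obtain ⟨he, hf, hle⟩ := hB (a + t) b c e (f + t) ((norm_add_le _ _).trans (by linarith))
      (by linarith) (by linarith) (by linarith) ((norm_add_le _ _).trans (by linarith))
      (by simp; linarith) k hk
    exact norm_mul_le_of_mul_eq_mul (mul_ne_zero (mul_ne_zero he hf) (one_add_nat_ne_zero k))
      (hypTerm_succ (a + t) b c e (f + t) k) hle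

/-- The nonterminating Saalschütz identity in regularized form. -/
theorem saalschutzSum_eq_saalschutzProd {a b c e f : ℂ} (hf : f = a + b + c - e + 1) :
    saalschutzSum a b c e f = saalschutzProd a b c e f := by
  have hre : f.re = a.re + b.re + c.re - e.re + 1 := by simp [hf]
  have hcast : Tendsto (fun t : ℝ => (t : ℂ)) (𝓝[>] 0) (𝓝 0) :=
    (Complex.continuous_ofReal.tendsto' 0 0 Complex.ofReal_zero).mono_left nhdsWithin_le_nhds
  have hG : ∀ (g : ℂ → ℂ) (z : ℂ), Continuous g → g 0 = z → Tendsto (fun t : ℝ => rGamma (g t))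
      (𝓝[>] 0) (𝓝 (rGamma z)) := by
    intro g z hg h0
    exact ((continuous_rGamma.comp hg).tendsto' 0 _ (by simp [h0])).comp hcast
  have t1 : Tendsto (fun t : ℝ => saalschutzSum (a + t) b c e (f + t)) (𝓝[>] 0)
      (𝓝 (saalschutzSum a b c e f)) := by
    have h1 := tendsto_tsum_hypTerm_add (a := a) (b := b) (c := c) (e := e) (f := f) (by linarith)
    have h2 := tendsto_tsum_hypTerm_add (a := a - e + 1) (b := b - e + 1) (c := c - e + 1)
      (e := 2 - e) (f := f - e + 1) (by simp; linarith)
    have g1 := hG (fun t => a + t - e + 1) (a - e + 1) (by fun_prop) (by ring)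
    have g2 := hG (fun t => a + t) a (by fun_prop) (by ring)
    have := (((g1.mul_const (rGamma (b - e + 1))).mul_const (rGamma (c - e + 1))).mul h1).sub
      (((g2.mul_const (rGamma b)).mul_const (rGamma c)).mul h2)
    refine this.congr fun t => ?_
    rw [saalschutzSum, show a + t - e + 1 = a - e + 1 + t by ring,
      show f + t - e + 1 = f - e + 1 + t by ring]
  have t2 : Tendsto (fun t : ℝ => saalschutzProd (a + t) b c e (f + t)) (𝓝[>] 0)
      (𝓝 (saalschutzProd a b c e f)) := by
    have g1 := hG (fun t => f + t - (a + t)) (f - a) (by fun_prop) (by ring)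
    have g2 := hG (fun t => f + t - b) (f - b) (by fun_prop) (by ring)
    have g3 := hG (fun t => f + t - c) (f - c) (by fun_prop) (by ring)
    exact ((g1.mul g2).mul g3).const_mul _
  refine tendsto_nhds_unique (t1.congr' ?_) t2
  filter_upwards [eventually_add_ne_intCast (f - b).re, eventually_add_ne_intCast (f - c).re]
    with t hb hc
  refine saalschutz_of_not_int (by rw [hf]; ring) (fun m hm => hb m ?_) fun m hm => hc m ?_
  · have := congrArg Complex.re hm
    simp at this ⊢
    linarith
  · simp at hm ⊢
    linarith

lemma hypTerm_eq_mul {e f : ℂ} (he : ∀ m : ℕ, e ≠ -(m : ℂ)) (hf : ∀ m : ℕ, f ≠ -(m : ℂ))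
    (a b c : ℂ) (k : ℕ) :
    poch a k * poch b k * poch c k / (poch e k * poch f k * (k.factorial : ℂ)) =
      Complex.Gamma e * Complex.Gamma f * hypTerm a b c e f k := by
  have h1 : Complex.Gamma e * rGamma e = 1 := mul_inv_cancel₀ (Complex.Gamma_ne_zero he)
  have h2 : Complex.Gamma f * rGamma f = 1 := mul_inv_cancel₀ (Complex.Gamma_ne_zero hf)
  have p1 := poch_ne_zero he k
  have p2 := poch_ne_zero hf k
  have h3 : (k.factorial : ℂ) ≠ 0 := by exact_mod_cast k.factorial_ne_zero
  rw [← poch_mul_rGamma_add e k] at h1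
  rw [← poch_mul_rGamma_add f k] at h2
  rw [hypTerm]
  field_simp
  linear_combination (-(poch a k * poch b k * poch c k)) *
    (h1 + Complex.Gamma e * (poch e k * rGamma (e + k)) * h2)

/-- Nonterminating Saalschütz identity (Gasper–Rahman (II.24)). -/
theorem gasper_rahman_II24 (a b c e : ℂ)
    (he : ∀ m : ℤ, e ≠ (m : ℂ))
    (h : ∀ z ∈ [a, b, c, a - e + 1, b - e + 1, c - e + 1, a + b + c - e + 1,
        a + b + c - 2 * e + 2],
      ∀ m : ℕ, z ≠ -(m : ℂ)) :
    (Summable fun k : ℕ =>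
      ‖poch a k * poch b k * poch c k /
        (poch e k * poch (a + b + c - e + 1) k * (Nat.factorial k : ℂ))‖) ∧
    (Summable fun k : ℕ =>
      ‖poch (a - e + 1) k * poch (b - e + 1) k * poch (c - e + 1) k /
        (poch (2 - e) k * poch (a + b + c - 2 * e + 2) k * (Nat.factorial k : ℂ))‖) ∧
    (∑' k : ℕ, poch a k * poch b k * poch c k /
        (poch e k * poch (a + b + c - e + 1) k * (Nat.factorial k : ℂ))) +
      Complex.Gamma (e - 1) * Complex.Gamma (a - e + 1) * Complex.Gamma (b - e + 1) *
          Complex.Gamma (c - e + 1) * Complex.Gamma (a + b + c - e + 1) /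
        (Complex.Gamma (1 - e) * Complex.Gamma a * Complex.Gamma b * Complex.Gamma c *
          Complex.Gamma (a + b + c - 2 * e + 2)) *
        (∑' k : ℕ, poch (a - e + 1) k * poch (b - e + 1) k * poch (c - e + 1) k /
          (poch (2 - e) k * poch (a + b + c - 2 * e + 2) k * (Nat.factorial k : ℂ))) =
    Complex.Gamma (a - e + 1) * Complex.Gamma (b - e + 1) * Complex.Gamma (c - e + 1) *
        Complex.Gamma (a + b + c - e + 1) /
      (Complex.Gamma (1 - e) * Complex.Gamma (b + c - e + 1) *
        Complex.Gamma (a + c - e + 1) * Complex.Gamma (a + b - e + 1)) := by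
  simp only [List.mem_cons, List.not_mem_nil, or_false, forall_eq_or_imp, forall_eq] at h
  obtain ⟨ha, hb, hc, ha', hb', hc', hf, hf'⟩ := h
  have he₁ : ∀ m : ℕ, e ≠ -(m : ℂ) := fun m hm => he (-m) (by push_cast; exact hm)
  have he₂ : ∀ m : ℕ, 2 - e ≠ -(m : ℂ) := fun m hm => he (2 + m) (by
    push_cast; linear_combination -hm)
  simp only [hypTerm_eq_mul he₁ hf, hypTerm_eq_mul he₂ hf']
  refine ⟨?_, ?_, ?_⟩
  · simp only [norm_mul (Complex.Gamma e * _)]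
    exact (summable_norm_hypTerm (by simp; linarith)).mul_left _
  · simp only [norm_mul (Complex.Gamma (2 - e) * _)]
    exact (summable_norm_hypTerm (by simp; linarith)).mul_left _
  rw [tsum_mul_left, tsum_mul_left]
  have main := saalschutzSum_eq_saalschutzProd (a := a) (b := b) (c := c) (e := e) rfl
  rw [saalschutzSum, saalschutzProd, show a + b + c - e + 1 - e + 1 = a + b + c - 2 * e + 2 by ring,
    show a + b + c - e + 1 - a = b + c - e + 1 by ring,
    show a + b + c - e + 1 - b = a + c - e + 1 by ring,
    show a + b + c - e + 1 - c = a + b - e + 1 by ring] at main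
  have h1e : (1 : ℂ) - e ≠ 0 := fun h0 => he 1 (by push_cast; linear_combination -h0)
  have g₁ : Complex.Gamma e = (e - 1) * Complex.Gamma (e - 1) := by
    rw [← Complex.Gamma_add_one _ (fun h0 => h1e (by linear_combination -h0)), sub_add_cancel]
  have g₂ : Complex.Gamma (2 - e) = (1 - e) * Complex.Gamma (1 - e) := by
    rw [← Complex.Gamma_add_one _ h1e]
    congr 1
    ring
  have n₁ := Complex.Gamma_ne_zero he₂
  have n₂ : Complex.Gamma (1 - e) ≠ 0 := by
    rw [g₂] at n₁; exact right_ne_zero_of_mul n₁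
  have na := Complex.Gamma_ne_zero ha'
  have nb := Complex.Gamma_ne_zero hb'
  have nc := Complex.Gamma_ne_zero hc'
  have nf := Complex.Gamma_ne_zero hf'
  have ne := Complex.Gamma_ne_zero he₁
  have ma := Complex.Gamma_ne_zero ha
  have mb := Complex.Gamma_ne_zero hb
  have mc := Complex.Gamma_ne_zero hc
  set S₁ := ∑' k, hypTerm a b c e (a + b + c - e + 1) k
  set S₂ := ∑' k, hypTerm (a - e + 1) (b - e + 1) (c - e + 1) (2 - e) (a + b + c - 2 * e + 2) k
  have m' := congrArg (fun x => Complex.Gamma (a - e + 1) * Complex.Gamma (b - e + 1) *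
    Complex.Gamma (c - e + 1) * Complex.Gamma (a + b + c - e + 1) * Complex.Gamma e * x) main
  simp only [rGamma] at m'
  calc _ = Complex.Gamma (a - e + 1) * Complex.Gamma (b - e + 1) *
        Complex.Gamma (c - e + 1) * Complex.Gamma (a + b + c - e + 1) * Complex.Gamma e *
        ((Complex.Gamma (a - e + 1))⁻¹ * (Complex.Gamma (b - e + 1))⁻¹ *
          (Complex.Gamma (c - e + 1))⁻¹ * S₁ -
        (Complex.Gamma a)⁻¹ * (Complex.Gamma b)⁻¹ * (Complex.Gamma c)⁻¹ * S₂) := by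
        rw [g₁, g₂]
        rw [g₁] at ne
        generalize Complex.Gamma (a + b + c - 2 * e + 2) = X at nf ⊢
        field_simp
        ring
    _ = _ := m'
    _ = _ := by
        field_simp
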